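/- Let V be a Jordan triple system, let w ∈ V be a maximal tripotent, let u ∈ V be a tripotent with D(w,w)u = u/2, and set w_u = 2{u,u,w}. Let a ∈ V be a tripotent with D(u,u)a = a/2, D(w_u,w_u)a = 0 and D(w,w)a = a/2. Then {a,u,a} = 0, the element u_a := 2{a,a,u} is a tripotent with u_a ≤ u (u − u_a is a tripotent orthogonal to u_a), and u_a lies in V_1(a): D(a,a)u_a = u_a/2. -/

import Mathlib

/-- A Jordan triple system: a complex vector space with a triple product
symmetric and linear in the outer variables, conjugate-linear in the middle
variable, satisfying the Jordan triple (main) identity. -/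
structure JordanTriple (V : Type*) [AddCommGroup V] [Module ℂ V] where
  tp : V → V → V → V
  symm_outer : ∀ a b c, tp a b c = tp c b a
  add_fst : ∀ a a' b c, tp (a + a') b c = tp a b c + tp a' b c
  smul_fst : ∀ (r : ℂ) (a b c : V), tp (r • a) b c = r • tp a b c
  add_snd : ∀ a b b' c, tp a (b + b') c = tp a b c + tp a b' c
  smul_snd : ∀ (r : ℂ) (a b c : V), tp a (r • b) c = (starRingEnd ℂ r) • tp a b c
  jordan_identity : ∀ a b x y z,
    tp a b (tp x y z) = tp (tp a b x) y z - tp x (tp b a y) z + tp x y (tp a b z)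

namespace JordanTriple

variable {V : Type*} [AddCommGroup V] [Module ℂ V]

/-- A tripotent: `{e,e,e} = e`. -/
def IsTripotent (T : JordanTriple V) (e : V) : Prop := T.tp e e e = e

/-- Orthogonality of elements: `D(x,y) = 0` and `D(y,x) = 0`. -/
def Orthogonal (T : JordanTriple V) (x y : V) : Prop :=
  (∀ z, T.tp x y z = 0) ∧ (∀ z, T.tp y x z = 0)

/-- A maximal (complete) tripotent: the Peirce projection
`P₀(w) = I - 2 D(w,w) + Q(w)²` vanishes on `V`. -/
def IsMaximalTripotent (T : JordanTriple V) (w : V) : Prop :=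
  T.IsTripotent w ∧ ∀ z : V, z - (2 : ℂ) • T.tp w w z + T.tp w (T.tp w z w) w = 0

/-- Orthogonality is symmetric: `D(a,a)b = 0` implies `D(b,b)a = 0`
(true in every JB*-triple). -/
def OrthSymm (T : JordanTriple V) : Prop :=
  ∀ a b : V, T.tp a a b = 0 → T.tp b b a = 0

end JordanTriple

variable {V : Type*} [AddCommGroup V] [Module ℂ V]

open JordanTriple

namespace JordanTriple

section Linearity

variable (T : JordanTriple V)

lemma add_thd (a b c c' : V) : T.tp a b (c + c') = T.tp a b c + T.tp a b c' := by
  rw [T.symm_outer, T.add_fst, T.symm_outer c, T.symm_outer c']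

lemma smul_thd (r : ℂ) (a b c : V) : T.tp a b (r • c) = r • T.tp a b c := by
  rw [T.symm_outer, T.smul_fst, T.symm_outer]

lemma zero_fst (b c : V) : T.tp 0 b c = 0 := by
  simpa using T.smul_fst 0 0 b c

lemma zero_snd (a c : V) : T.tp a 0 c = 0 := by
  simpa using T.smul_snd 0 a 0 c

lemma zero_thd (a b : V) : T.tp a b 0 = 0 := by
  rw [T.symm_outer, zero_fst]

/-- The Peirce multiplication rule for eigenvectors of `D(e,e)` with real eigenvalues. -/
lemma peirce_mul {e x y z : V} {r s t : ℂ} (hs : starRingEnd ℂ s = s)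
    (hx : T.tp e e x = r • x) (hy : T.tp e e y = s • y) (hz : T.tp e e z = t • z) :
    T.tp e e (T.tp x y z) = (r - s + t) • T.tp x y z := by
  rw [T.jordan_identity, hx, hy, hz, T.smul_fst, T.smul_snd, T.smul_thd, hs]
  module

end Linearity

variable {T : JordanTriple V} {e : V}

namespace IsTripotent

lemma tp_quad (he : T.IsTripotent e) (z : V) :
    T.tp e e (T.tp e z e) = T.tp e z e ∧ T.tp e (T.tp e e z) e = T.tp e z e := by
  have he' : T.tp e e e = e := he
  have h1 := T.jordan_identity e e e z e
  have h2 := T.jordan_identity e z e e e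
  rw [he'] at h1 h2
  rw [T.symm_outer (T.tp e z e) e e, T.symm_outer z e e] at h2
  constructor
  · linear_combination (norm := module) (1/3 : ℂ) • h1 - (1/3 : ℂ) • h2
  · linear_combination (norm := module) (2/3 : ℂ) • h1 + (1/3 : ℂ) • h2

lemma tp_eq (he : T.IsTripotent e) (z : V) :
    T.tp e e z = (2 : ℂ) • T.tp e e (T.tp e e z) - T.tp e (T.tp e z e) e := by
  have he' : T.tp e e e = e := he
  have h := T.jordan_identity z e e e e
  rw [he', T.symm_outer z e e, T.symm_outer (T.tp e e z) e e] at h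
  linear_combination (norm := module) h

/-- The only eigenvalues of `D(e,e)` are `0`, `1/2` and `1`. -/
lemma eq_zero_of_eigenvalue (he : T.IsTripotent e) {z : V} {r : ℂ}
    (hz : T.tp e e z = r • z) (hr : r * (r - 1) * (2 * r - 1) ≠ 0) : z = 0 := by
  have h := he.tp_eq z
  have h' := congrArg (T.tp e e) (show T.tp e (T.tp e z e) e =
    (2 : ℂ) • T.tp e e (T.tp e e z) - T.tp e e z by linear_combination (norm := module) h)
  rw [(he.tp_quad _).1] at h'
  simp only [hz, T.smul_thd, sub_eq_add_neg, ← neg_one_smul ℂ (r • z), T.add_thd] at h h'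
  have h0 : (r * (r - 1) * (2 * r - 1)) • z = 0 := by
    linear_combination (norm := module) h - h'
  exact (smul_eq_zero.mp h0).resolve_left hr

/-- A tripotent is orthogonal to its Peirce-zero space. -/
lemma orthogonal_of_tp_eq_zero (he : T.IsTripotent e) {x : V} (hx : T.tp e e x = 0) :
    T.Orthogonal e x := by
  have he' : T.tp e e e = e := he
  have hq : T.tp e x e = 0 := by rw [← (he.tp_quad x).2, hx, T.zero_snd]
  have hx' : T.tp x e e = 0 := by rw [T.symm_outer, hx]
  constructor <;> intro z
  · have h1 := T.jordan_identity e x e e z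
    have h2 := T.jordan_identity e e e x z
    rw [hq, hx', T.zero_fst, T.zero_snd] at h1
    rw [he', hx, T.zero_snd] at h2
    linear_combination (norm := module) -h1 - h2
  · have h1 := T.jordan_identity x e e e z
    have h2 := T.jordan_identity e e x e z
    rw [hq, hx', T.zero_fst, T.zero_snd] at h1
    rw [he', hx, T.zero_fst] at h2
    linear_combination (norm := module) h1 + h2

/-- If a tripotent `e` lies in the Peirce-one space of a tripotent `u` and `{e,u,e} = 0`,
then `u` splits as the sum of the orthogonal tripotents `p = 2{e,e,u}` and `u - p`, and
`e`, `p` are collinear. -/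
lemma peirce_one_split {u p : V} (he : T.IsTripotent e) (hu : T.IsTripotent u)
    (hue : T.tp u u e = (1/2 : ℂ) • e) (heu : T.tp e u e = 0)
    (hp : p = (2 : ℂ) • T.tp e e u) :
    T.IsTripotent p ∧ T.IsTripotent (u - p) ∧ T.Orthogonal (u - p) p ∧
      T.tp e e p = (1/2 : ℂ) • p ∧ T.tp p p e = (1/2 : ℂ) • e := by
  have he1 : T.tp e e e = (1 : ℂ) • e := by rw [one_smul]; exact he
  have hhalf : starRingEnd ℂ (1/2) = 1/2 := by simp [map_ofNat]
  have hpu : T.tp e e u = (1/2 : ℂ) • p := by rw [hp]; module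
  have hDp : T.tp e e p = (1/2 : ℂ) • p := by
    have h := he.tp_eq u
    rw [heu, T.zero_snd, hpu, T.smul_thd] at h
    linear_combination (norm := module) -h
  obtain ⟨q, hq⟩ : ∃ q, q = u - p := ⟨_, rfl⟩
  have hupq : u = p + q := by rw [hq]; abel
  have hDq : T.tp e e q = (0 : ℂ) • q := by
    have h := hpu
    rw [hupq, T.add_thd, hDp] at h
    linear_combination (norm := module) h
  have hort := he.orthogonal_of_tp_eq_zero (hDq.trans (zero_smul ℂ q))
  have hpqe : T.tp p q e = 0 := by rw [T.symm_outer, hort.1]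
  have hqqe : T.tp q q e = 0 := by rw [T.symm_outer, hort.1]
  have h0 : starRingEnd ℂ 0 = 0 := map_zero _
  have hsum : T.tp p p e + T.tp q p e = (1/2 : ℂ) • e := by
    have h := hue
    rw [hupq] at h
    simpa only [T.add_fst, T.add_snd, hpqe, hqqe, add_zero] using h
  have hqpe : T.tp q p e = 0 := by
    have h := congrArg (T.tp e e) hsum
    rw [T.add_thd, T.smul_thd, T.peirce_mul hhalf hDp hDp he1, T.peirce_mul hhalf hDq hDp he1,
      he1] at h
    linear_combination (norm := module) (2 : ℂ) • hsum - (2 : ℂ) • h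
  have hppe : T.tp p p e = (1/2 : ℂ) • e := by rw [← hsum, hqpe, add_zero]
  have hqpq : T.tp q p q = 0 :=
    he.eq_zero_of_eigenvalue (T.peirce_mul hhalf hDq hDp hDq) (by norm_num)
  have hqpp : T.tp q p p = 0 := by
    have h := T.jordan_identity q p e e u
    rw [hqpe, hpqe, T.zero_fst, T.zero_snd, hpu, hupq, T.add_thd, T.add_thd, hqpq, T.zero_thd,
      T.peirce_mul hhalf hDq hDp hDp, T.smul_thd] at h
    linear_combination (norm := module) (2 : ℂ) • h
  have hpq : T.tp p q p + T.tp p q q = 0 := by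
    have h := T.jordan_identity p q e e u
    rw [hqpe, hpqe, T.zero_fst, T.zero_snd, hpu, hupq, T.add_thd, T.add_thd,
      T.peirce_mul h0 hDp hDq hDp, T.peirce_mul h0 hDp hDq hDq, T.smul_thd] at h
    linear_combination (norm := module) (-2 : ℂ) • h
  have hpqp : T.tp p q p = 0 := by
    have h := congrArg (T.tp e e) hpq
    rw [T.add_thd, T.peirce_mul h0 hDp hDq hDp, T.peirce_mul h0 hDp hDq hDq, T.zero_thd] at h
    linear_combination (norm := module) (2 : ℂ) • h - hpq
  have hpqq : T.tp p q q = 0 := by rwa [hpqp, zero_add] at hpq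
  have hppq : T.tp p p q = 0 := by rw [T.symm_outer, hqpp]
  have hqqp : T.tp q q p = 0 := by rw [T.symm_outer, hpqq]
  have hcube : T.tp p p p + T.tp q q q = p + q := by
    have h : T.tp u u u = u := hu
    rw [hupq] at h
    simpa only [T.add_fst, T.add_snd, T.add_thd, hqpq, hqpp, hpqp, hpqq, hppq, hqqp, add_zero,
      zero_add] using h
  have hp3 : T.tp p p p = p := by
    have h := congrArg (T.tp e e) hcube
    rw [T.add_thd, T.add_thd, T.peirce_mul hhalf hDp hDp hDp, T.peirce_mul h0 hDq hDq hDq,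
      hDp, hDq] at h
    linear_combination (norm := module) (2 : ℂ) • h
  have hq3 : T.tp q q q = q := by rw [hp3] at hcube; exact add_left_cancel hcube
  have hortpq := orthogonal_of_tp_eq_zero hp3 hppq
  rw [← hq]
  exact ⟨hp3, hq3, ⟨hortpq.2, hortpq.1⟩, hDp, hppe⟩

end IsTripotent

/-- The Peirce-zero space of a maximal tripotent is trivial. -/
lemma IsMaximalTripotent.eq_zero {w z : V} (hw : T.IsMaximalTripotent w)
    (hz : T.tp w w z = 0) : z = 0 := by
  have hq : T.tp w z w = 0 := by rw [← (hw.1.tp_quad z).2, hz, T.zero_snd]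
  simpa [hz, hq, T.zero_snd] using hw.2 z

end JordanTriple

/-- Let `w` be a maximal tripotent, `u` a tripotent with `D(w,w)u = u/2`, and
`w_u = 2{u,u,w}`.  If `a` is a tripotent with `a ∈ V₁(u) ∩ V₀(w_u) ∩ V₁(w)`,
then `{a,u,a} = 0`, `u_a := 2{a,a,u}` is a tripotent with `u_a ≤ u`, and
`u_a ∈ V₁(a)`. -/
theorem ua_tripotent_le (T : JordanTriple V) (w u : V)
    (hw : T.IsMaximalTripotent w) (hu : T.IsTripotent u)
    (h1 : T.tp w w u = (1/2 : ℂ) • u)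
    (wu : V) (hwu : wu = (2 : ℂ) • T.tp u u w)
    (a : V) (ha : T.IsTripotent a)
    (ha1 : T.tp u u a = (1/2 : ℂ) • a)
    (ha2 : T.tp wu wu a = 0)
    (ha3 : T.tp w w a = (1/2 : ℂ) • a)
    (ua : V) (hua : ua = (2 : ℂ) • T.tp a a u) :
    T.tp a u a = 0 ∧
    T.IsTripotent ua ∧
    (T.IsTripotent (u - ua) ∧ T.Orthogonal (u - ua) ua) ∧
    T.tp a a ua = (1/2 : ℂ) • ua := by
  have hhalf : starRingEnd ℂ (1/2) = 1/2 := by simp [map_ofNat]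
  have huwu : T.tp u w u = 0 := by
    have hw1 : T.tp w w w = (1 : ℂ) • w := by rw [one_smul]; exact hw.1
    refine hw.eq_zero ?_
    rw [T.peirce_mul (map_one _) h1 hw1 h1]
    module
  obtain ⟨hwu3, -, -, -, hwuu⟩ := hu.peirce_one_split hw.1 h1 huwu hwu
  have haua : T.tp a u a = 0 :=
    hwu3.eq_zero_of_eigenvalue
      (T.peirce_mul hhalf (ha2.trans (zero_smul ℂ a).symm) hwuu
        (ha2.trans (zero_smul ℂ a).symm)) (by norm_num)
  obtain ⟨hua3, hdiff, hort, hDua, -⟩ := ha.peirce_one_split hu ha1 haua hua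
  exact ⟨haua, hua3, ⟨hdiff, hort⟩, hDua⟩
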